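/- For every integer m ≥ 4, every m-fragile finite simple graph G satisfies: for all pairwise distinct vertices x, y, z of G, there exists a proper colouring c of G with colours from {1, …, m} such that c(x) ∉ {c(y), c(z)}. -/

import Mathlib

/-- A graph is `k`-connected if it has at least `k+1` vertices and deleting any set of
at most `k-1` vertices leaves a connected (in particular nonempty) graph. -/
def SimpleGraph.IsKConnected {V : Type*} (G : SimpleGraph V) (k : ℕ) : Prop :=
  k + 1 ≤ Nat.card V ∧ ∀ S : Set V, S.ncard ≤ k - 1 → (G.induce Sᶜ).Connected

/-- A graph is fragile if it has no 3-connected subgraph. -/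
def SimpleGraph.Fragile {V : Type*} (G : SimpleGraph V) : Prop :=
  ∀ H : G.Subgraph, ¬ H.coe.IsKConnected 3

/-- A graph is `m`-fragile if every 3-connected subgraph of it is `(m-1)`-colourable. -/
def SimpleGraph.MFragile {V : Type*} (m : ℕ) (G : SimpleGraph V) : Prop :=
  ∀ H : G.Subgraph, H.coe.IsKConnected 3 → H.coe.Colorable (m - 1)

namespace SimpleGraph

variable {V : Type*}

/-- `c` is a proper colouring of the subgraph of `G` induced by `S`. -/
def ProperOn {m : ℕ} (G : SimpleGraph V) (S : Set V) (c : V → Fin m) : Prop :=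
  ∀ u ∈ S, ∀ v ∈ S, G.Adj u v → c u ≠ c v

/-- `(A, B)` is a separation of the subgraph of `G` induced by `S`, with separator `{p, q}`. -/
structure TwoSeparation (G : SimpleGraph V) (S A B : Set V) (p q : V) : Prop where
  ne : p ≠ q
  union : A ∪ B = S
  inter : A ∩ B = {p, q}
  not_adj : ∀ u ∈ A \ B, ∀ v ∈ B \ A, ¬ G.Adj u v
  left_nonempty : (A \ B).Nonempty
  right_nonempty : (B \ A).Nonempty

/-- The colouring properties of the subgraph of `G` induced by `S` that are stable under gluing
along separators of size two. -/
structure FlexiblyColourable (G : SimpleGraph V) (m : ℕ) (S : Set V) : Prop where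
  eq : ∀ u ∈ S, ∀ v ∈ S, u ≠ v → ¬ G.Adj u v → ∃ c : V → Fin m, G.ProperOn S c ∧ c u = c v
  single : ∀ x ∈ S, ∀ y ∈ S, ∀ z ∈ S, x ≠ y → x ≠ z →
    ∃ c : V → Fin m, G.ProperOn S c ∧ c x ≠ c y ∧ c x ≠ c z
  pair : ∀ a ∈ S, ∀ b ∈ S, ∀ v ∈ S, a ≠ b → a ≠ v → b ≠ v →
    ¬ (G.Adj a b ∧ G.Adj a v ∧ G.Adj b v) →
    ∃ c : V → Fin m, G.ProperOn S c ∧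
      (c a = c b ∧ c a ≠ c v ∨ c a = c v ∧ c a ≠ c b ∨ c b = c v ∧ c a ≠ c b)

/-- Some proper colouring on `A` realises the prescribed equalities between the colours
of `a`, `p` and `q`. -/
def HasPattern (G : SimpleGraph V) (m : ℕ) (A : Set V) (a p q : V) (i j k : Prop) : Prop :=
  ∃ c : V → Fin m, G.ProperOn A c ∧ (c p = c q ↔ i) ∧ (c a = c p ↔ j) ∧ (c a = c q ↔ k)

theorem exists_perm_of_same_pattern {K : Type*} [DecidableEq K] {p q a p' q' a' : K}
    (hpq : p = q ↔ p' = q') (hap : a = p ↔ a' = p') (haq : a = q ↔ a' = q') :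
    ∃ σ : Equiv.Perm K, σ p = p' ∧ σ q = q' ∧ σ a = a' := by
  obtain ⟨σ, hp, hq⟩ : ∃ σ : Equiv.Perm K, σ p = p' ∧ σ q = q' := by
    refine ⟨(Equiv.swap p p').trans (Equiv.swap (Equiv.swap p p' q) q'), ?_, ?_⟩ <;>
      simp only [Equiv.trans_apply, Equiv.swap_apply_def] <;> grind
  refine ⟨σ.trans (Equiv.swap (σ a) a'), ?_, ?_, ?_⟩
  · have : σ a = σ p ↔ a = p := σ.injective.eq_iff
    simp only [Equiv.trans_apply, Equiv.swap_apply_def]; grind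
  · have : σ a = σ q ↔ a = q := σ.injective.eq_iff
    simp only [Equiv.trans_apply, Equiv.swap_apply_def]; grind
  · simp

theorem exists_fin_ne_three {m : ℕ} (hm : 4 ≤ m) (x y z : Fin m) :
    ∃ t : Fin m, t ≠ x ∧ t ≠ y ∧ t ≠ z := by
  by_contra! h
  have : (Finset.univ : Finset (Fin m)) ⊆ {x, y, z} := fun t _ => by
    have := h t
    simp only [Finset.mem_insert, Finset.mem_singleton]; tauto
  have := Finset.card_le_card this
  have := Finset.card_le_three (a := x) (b := y) (c := z)
  simp at *; omega

theorem exists_fin_ne_four {m : ℕ} (hm : 5 ≤ m) (x y z w : Fin m) :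
    ∃ t : Fin m, t ≠ x ∧ t ≠ y ∧ t ≠ z ∧ t ≠ w := by
  by_contra! h
  have : (Finset.univ : Finset (Fin m)) ⊆ {x, y, z, w} := fun t _ => by
    have := h t
    simp only [Finset.mem_insert, Finset.mem_singleton]; tauto
  have := Finset.card_le_card this
  have := Finset.card_le_four (a := x) (b := y) (c := z) (d := w)
  simp at *; omega

namespace TwoSeparation

variable {G : SimpleGraph V} {S A B : Set V} {p q : V} {m : ℕ}

theorem symm (h : G.TwoSeparation S A B p q) : G.TwoSeparation S B A p q where
  ne := h.ne
  union := by rw [Set.union_comm, h.union]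
  inter := by rw [Set.inter_comm, h.inter]
  not_adj u hu v hv huv := h.not_adj v hv u hu huv.symm
  left_nonempty := h.right_nonempty
  right_nonempty := h.left_nonempty

theorem swap (h : G.TwoSeparation S A B p q) : G.TwoSeparation S A B q p where
  ne := h.ne.symm
  union := h.union
  inter := by rw [h.inter, Set.pair_comm]
  not_adj := h.not_adj
  left_nonempty := h.left_nonempty
  right_nonempty := h.right_nonempty

theorem mem_inter_iff (h : G.TwoSeparation S A B p q) (v : V) :
    v ∈ A ∧ v ∈ B ↔ v = p ∨ v = q := by
  have := Set.ext_iff.1 h.inter v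
  simpa using this

theorem mem_iff (h : G.TwoSeparation S A B p q) (v : V) : v ∈ S ↔ v ∈ A ∨ v ∈ B := by
  rw [← h.union, Set.mem_union]

theorem left_mem (h : G.TwoSeparation S A B p q) : p ∈ A ∧ p ∈ B :=
  (h.mem_inter_iff p).2 (Or.inl rfl)

theorem right_mem (h : G.TwoSeparation S A B p q) : q ∈ A ∧ q ∈ B :=
  (h.mem_inter_iff q).2 (Or.inr rfl)

/-- A colouring on `B` extends to `S`, giving the vertex `a` of `A` the colour `t`, whenever
`A` admits a colouring with the matching pattern. -/
theorem extend (h : G.TwoSeparation S A B p q) {a : V} (ha : a ∈ A) {i j k : Prop}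
    (hA : G.HasPattern m A a p q i j k) {c₂ : V → Fin m} (hc₂ : G.ProperOn B c₂) (t : Fin m)
    (hi : c₂ p = c₂ q ↔ i) (hj : t = c₂ p ↔ j) (hk : t = c₂ q ↔ k) :
    ∃ c : V → Fin m, G.ProperOn S c ∧ (∀ v ∈ B, c v = c₂ v) ∧ c a = t := by
  classical
  obtain ⟨c₁, hc₁, hi', hj', hk'⟩ := hA
  obtain ⟨σ, hp, hq, hσ⟩ := exists_perm_of_same_pattern (hi'.trans hi.symm) (hj'.trans hj.symm)
    (hk'.trans hk.symm)
  have hagree : ∀ v ∈ A, v ∈ B → c₂ v = σ (c₁ v) := by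
    intro v hvA hvB
    rcases (h.mem_inter_iff v).1 ⟨hvA, hvB⟩ with rfl | rfl
    · exact hp.symm
    · exact hq.symm
  refine ⟨fun v => if v ∈ B then c₂ v else σ (c₁ v), ?_, fun v hv => if_pos hv, ?_⟩
  · have hA' : ∀ v ∈ A, (if v ∈ B then c₂ v else σ (c₁ v)) = σ (c₁ v) := by
      intro v hv
      split_ifs with hvB
      · exact hagree v hv hvB
      · rfl
    intro u hu v hv huv
    by_cases huB : u ∈ B
    · by_cases hvB : v ∈ B
      · simpa [huB, hvB] using hc₂ u huB v hvB huv
      · have hvA : v ∈ A := ((h.mem_iff v).1 hv).resolve_right hvB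
        have huA : u ∈ A := by
          by_contra huA
          exact h.not_adj v ⟨hvA, hvB⟩ u ⟨huB, huA⟩ huv.symm
        simpa only [hA' u huA, hA' v hvA, ne_eq, σ.injective.eq_iff] using hc₁ u huA v hvA huv
    · have huA : u ∈ A := ((h.mem_iff u).1 hu).resolve_right huB
      have hvA : v ∈ A := by
        by_contra hvA
        exact h.not_adj u ⟨huA, huB⟩ v ⟨((h.mem_iff v).1 hv).resolve_left hvA, hvA⟩ huv
      simpa only [hA' u huA, hA' v hvA, ne_eq, σ.injective.eq_iff] using hc₁ u huA v hvA huv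
  · by_cases haB : a ∈ B
    · simp [haB, hagree a ha haB, hσ]
    · simp [haB, hσ]

end TwoSeparation

namespace FlexiblyColourable

variable {G : SimpleGraph V} {A : Set V} {a p q : V} {m : ℕ}

theorem hasPattern_single (h : G.FlexiblyColourable m A) (ha : a ∈ A) (hp : p ∈ A) (hq : q ∈ A)
    (hap : a ≠ p) (haq : a ≠ q) :
    G.HasPattern m A a p q False False False ∨ G.HasPattern m A a p q True False False := by
  obtain ⟨c, hc, h₁, h₂⟩ := h.single a ha p hp q hq hap haq
  by_cases hpq : c p = c q
  · exact Or.inr ⟨c, hc, by simp [*], by simp [*], by simp [*]⟩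
  · exact Or.inl ⟨c, hc, by simp [*], by simp [*], by simp [*]⟩

theorem hasPattern_single_left (h : G.FlexiblyColourable m A) (ha : a ∈ A) (hp : p ∈ A)
    (hq : q ∈ A) (hap : a ≠ p) (hpq : p ≠ q) :
    G.HasPattern m A a p q False False False ∨ G.HasPattern m A a p q False False True := by
  obtain ⟨c, hc, h₁, h₂⟩ := h.single p hp a ha q hq hap.symm hpq
  by_cases haq : c a = c q
  · exact Or.inr ⟨c, hc, by simp [*], by grind, by simp [*]⟩
  · exact Or.inl ⟨c, hc, by simp [*], by grind, by simp [*]⟩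

theorem hasPattern_single_right (h : G.FlexiblyColourable m A) (ha : a ∈ A) (hp : p ∈ A)
    (hq : q ∈ A) (haq : a ≠ q) (hpq : p ≠ q) :
    G.HasPattern m A a p q False False False ∨ G.HasPattern m A a p q False True False := by
  obtain ⟨c, hc, h₁, h₂⟩ := h.single q hq a ha p hp haq.symm hpq.symm
  by_cases hap : c a = c p
  · exact Or.inr ⟨c, hc, by grind, by grind, by grind⟩
  · exact Or.inl ⟨c, hc, by grind, by grind, by grind⟩

theorem hasPattern_eq (h : G.FlexiblyColourable m A) (hp : p ∈ A) (hq : q ∈ A)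
    (hpq : p ≠ q) (hadj : ¬ G.Adj p q) :
    G.HasPattern m A a p q True False False ∨ G.HasPattern m A a p q True True True := by
  obtain ⟨c, hc, h₁⟩ := h.eq p hp q hq hpq hadj
  by_cases hap : c a = c p
  · exact Or.inr ⟨c, hc, by grind, by grind, by grind⟩
  · exact Or.inl ⟨c, hc, by grind, by grind, by grind⟩

theorem hasPattern_pair (h : G.FlexiblyColourable m A) (ha : a ∈ A) (hp : p ∈ A) (hq : q ∈ A)
    (hap : a ≠ p) (haq : a ≠ q) (hpq : p ≠ q) (hadj : ¬ (G.Adj a p ∧ G.Adj a q ∧ G.Adj p q)) :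
    G.HasPattern m A a p q True False False ∨ G.HasPattern m A a p q False True False ∨
      G.HasPattern m A a p q False False True := by
  obtain ⟨c, hc, h₁ | h₁ | h₁⟩ := h.pair a ha p hp q hq hap haq hpq hadj
  · exact Or.inr <| Or.inl ⟨c, hc, by grind, by grind, by grind⟩
  · exact Or.inr <| Or.inr ⟨c, hc, by grind, by grind, by grind⟩
  · exact Or.inl ⟨c, hc, by grind, by grind, by grind⟩

end FlexiblyColourable

theorem HasPattern.not_adj {G : SimpleGraph V} {A : Set V} {a p q : V} {m : ℕ} {j k : Prop}
    (h : G.HasPattern m A a p q True j k) (hp : p ∈ A) (hq : q ∈ A) : ¬ G.Adj p q := by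
  obtain ⟨c, hc, h₁, -⟩ := h
  exact fun hpq => hc p hp q hq hpq (h₁.2 trivial)

namespace TwoSeparation

variable {G : SimpleGraph V} {S A B : Set V} {p q a b : V} {m : ℕ}

theorem ne_of_left (h : G.TwoSeparation S A B p q) (ha : a ∈ A \ B) : a ≠ p ∧ a ≠ q :=
  ⟨fun e => ha.2 (e ▸ h.left_mem.2), fun e => ha.2 (e ▸ h.right_mem.2)⟩

theorem cases (h : G.TwoSeparation S A B p q) {v : V} (hv : v ∈ S) :
    v ∈ A \ B ∨ v ∈ B \ A ∨ v = p ∨ v = q := by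
  have h₁ := h.mem_inter_iff v
  have h₂ := h.mem_iff v
  simp only [Set.mem_sdiff]
  tauto

theorem ssubset (h : G.TwoSeparation S A B p q) : A ⊂ S := by
  refine ⟨fun v hv => (h.mem_iff v).2 (Or.inl hv), fun hS => ?_⟩
  obtain ⟨v, hvB, hvA⟩ := h.right_nonempty
  exact hvA (hS ((h.mem_iff v).2 (Or.inr hvB)))

theorem extend_right (h : G.TwoSeparation S A B p q) (hA : G.FlexiblyColourable m A)
    {c₂ : V → Fin m} (hc₂ : G.ProperOn B c₂) :
    ∃ c : V → Fin m, G.ProperOn S c ∧ ∀ v ∈ B, c v = c₂ v := by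
  have key : G.HasPattern m A p p q (c₂ p = c₂ q) True (c₂ p = c₂ q) := by
    by_cases hpq : c₂ p = c₂ q
    · obtain ⟨c, hc, h₁⟩ := hA.eq p h.left_mem.1 q h.right_mem.1 h.ne
        fun hadj => hc₂ p h.left_mem.2 q h.right_mem.2 hadj hpq
      exact ⟨c, hc, by simp [*], by simp, by simp [*]⟩
    · obtain ⟨c, hc, h₁, -⟩ := hA.single p h.left_mem.1 q h.right_mem.1 q h.right_mem.1 h.ne h.ne
      exact ⟨c, hc, by simp [*], by simp, by simp [*]⟩
  obtain ⟨c, hc, h₁, -⟩ := h.extend h.left_mem.1 key hc₂ (c₂ p) Iff.rfl (by simp) Iff.rfl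
  exact ⟨c, hc, h₁⟩

theorem glue_eq (h : G.TwoSeparation S A B p q) (ha : a ∈ A) (hb : b ∈ B) {i j k : Prop}
    (hA : G.HasPattern m A a p q i j k) (hB : G.HasPattern m B b p q i j k) :
    ∃ c : V → Fin m, G.ProperOn S c ∧ c a = c b ∧ (c b = c p ↔ j) ∧ (c b = c q ↔ k) := by
  obtain ⟨c₂, hc₂, h₁, h₂, h₃⟩ := hB
  obtain ⟨c, hc, hB, hca⟩ := h.extend ha hA hc₂ (c₂ b) h₁ h₂ h₃
  have := hB b hb
  have := hB p h.left_mem.2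
  have := hB q h.right_mem.2
  exact ⟨c, hc, by grind, by grind, by grind⟩

theorem glue_ne (h : G.TwoSeparation S A B p q) (hm : 4 ≤ m) (ha : a ∈ A) (hb : b ∈ B)
    {i j k j' k' : Prop} (hA : G.HasPattern m A a p q i j k)
    (hB : G.HasPattern m B b p q i j' k') (hj : ¬ (j ∧ j')) (hk : ¬ (k ∧ k')) :
    ∃ c : V → Fin m, G.ProperOn S c ∧ c a ≠ c b ∧ (c a = c p ↔ j) ∧ (c a = c q ↔ k) ∧
      (c b = c p ↔ j') ∧ (c b = c q ↔ k') := by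
  obtain ⟨c₂, hc₂, h₁, h₂, h₃⟩ := hB
  obtain ⟨t, ht, ht₁, ht₂⟩ : ∃ t, t ≠ c₂ b ∧ (t = c₂ p ↔ j) ∧ (t = c₂ q ↔ k) := by
    obtain ⟨c₁, -, g₁, g₂, g₃⟩ := hA
    obtain ⟨t, t₁, t₂, t₃⟩ := exists_fin_ne_three hm (c₂ p) (c₂ q) (c₂ b)
    by_cases hj' : j
    · exact ⟨c₂ p, by grind, by grind, by grind⟩
    · by_cases hk' : k
      · exact ⟨c₂ q, by grind, by grind, by grind⟩
      · exact ⟨t, by grind, by grind, by grind⟩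
  obtain ⟨c, hc, hB, hca⟩ := h.extend ha hA hc₂ t h₁ ht₁ ht₂
  have := hB b hb
  have := hB p h.left_mem.2
  have := hB q h.right_mem.2
  exact ⟨c, hc, by grind, by grind, by grind, by grind, by grind⟩

theorem patterns (h : G.TwoSeparation S A B p q) (hA : G.FlexiblyColourable m A)
    (ha : a ∈ A \ B) :
    G.HasPattern m A a p q False False False ∨ G.HasPattern m A a p q True False False ∧
      G.HasPattern m A a p q False True False ∧ G.HasPattern m A a p q False False True := by
  obtain ⟨hap, haq⟩ := h.ne_of_left ha
  have hp := h.left_mem.1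
  have hq := h.right_mem.1
  have h₁ := hA.hasPattern_single ha.1 hp hq hap haq
  have h₂ := hA.hasPattern_single_left ha.1 hp hq hap h.ne
  have h₃ := hA.hasPattern_single_right ha.1 hp hq haq h.ne
  tauto

theorem exists_eq_of_distinct (h : G.TwoSeparation S A B p q) (hA : G.FlexiblyColourable m A)
    (ha : a ∈ A \ B) (hb : b ∈ B \ A) (hd : G.HasPattern m A a p q False False False)
    (hB : G.FlexiblyColourable m B) :
    ∃ c : V → Fin m, G.ProperOn S c ∧ c a = c b := by
  rcases h.symm.patterns hB hb with hB' | ⟨hB₁, hB₂, hB₃⟩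
  · exact (h.glue_eq ha.1 hb.1 hd hB').imp fun c hc => ⟨hc.1, hc.2.1⟩
  · obtain ⟨hap, haq⟩ := h.ne_of_left ha
    have hpq := hB₁.not_adj h.left_mem.2 h.right_mem.2
    rcases hA.hasPattern_pair ha.1 h.left_mem.1 h.right_mem.1 hap haq h.ne
      (fun hadj => hpq hadj.2.2) with hA' | hA' | hA'
    · exact (h.glue_eq ha.1 hb.1 hA' hB₁).imp fun c hc => ⟨hc.1, hc.2.1⟩
    · exact (h.glue_eq ha.1 hb.1 hA' hB₂).imp fun c hc => ⟨hc.1, hc.2.1⟩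
    · exact (h.glue_eq ha.1 hb.1 hA' hB₃).imp fun c hc => ⟨hc.1, hc.2.1⟩

theorem exists_eq (h : G.TwoSeparation S A B p q) (hA : G.FlexiblyColourable m A)
    (hB : G.FlexiblyColourable m B) (ha : a ∈ A \ B) (hb : b ∈ B \ A) :
    ∃ c : V → Fin m, G.ProperOn S c ∧ c a = c b := by
  rcases h.patterns hA ha with hd | ⟨hA₁, -, -⟩
  · exact h.exists_eq_of_distinct hA ha hb hd hB
  · rcases h.symm.patterns hB hb with hd | ⟨hB₁, -, -⟩
    · exact (h.symm.exists_eq_of_distinct hB hb ha hd hA).imp fun c hc => ⟨hc.1, hc.2.symm⟩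
    · exact (h.glue_eq ha.1 hb.1 hA₁ hB₁).imp fun c hc => ⟨hc.1, hc.2.1⟩

theorem exists_pair_separator (h : G.TwoSeparation S A B p q) (hm : 4 ≤ m)
    (hA : G.FlexiblyColourable m A) (hB : G.FlexiblyColourable m B)
    (ha : a ∈ A \ B) (hb : b ∈ B \ A) :
    ∃ c : V → Fin m, G.ProperOn S c ∧
      (c a = c p ∧ c a ≠ c b ∨ c a = c b ∧ c a ≠ c p ∨ c p = c b ∧ c a ≠ c p) := by
  rcases h.patterns hA ha with hA₀ | ⟨hA₁, hA₂, hA₃⟩ <;>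
    rcases h.symm.patterns hB hb with hB₀ | ⟨hB₁, hB₂, hB₃⟩
  · obtain ⟨c, hc, h₁⟩ := h.glue_eq ha.1 hb.1 hA₀ hB₀
    exact ⟨c, hc, by grind⟩
  · obtain ⟨c, hc, h₁⟩ := h.glue_ne hm ha.1 hb.1 hA₀ hB₂ (by simp) (by simp)
    exact ⟨c, hc, by grind⟩
  · obtain ⟨c, hc, h₁⟩ := h.glue_ne hm ha.1 hb.1 hA₂ hB₀ (by simp) (by simp)
    exact ⟨c, hc, by grind⟩
  · obtain ⟨c, hc, h₁⟩ := h.glue_eq ha.1 hb.1 hA₁ hB₁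
    exact ⟨c, hc, by grind⟩

theorem exists_single_left_separator (h : G.TwoSeparation S A B p q) (hm : 4 ≤ m)
    (hA : G.FlexiblyColourable m A) (hB : G.FlexiblyColourable m B)
    (ha : a ∈ A \ B) (hb : b ∈ B \ A) :
    ∃ c : V → Fin m, G.ProperOn S c ∧ c a ≠ c p ∧ c a ≠ c b := by
  rcases h.patterns hA ha with hA₀ | ⟨hA₁, hA₂, hA₃⟩ <;>
    rcases h.symm.patterns hB hb with hB₀ | ⟨hB₁, hB₂, hB₃⟩
  · obtain ⟨c, hc, h₁⟩ := h.glue_ne hm ha.1 hb.1 hA₀ hB₀ (by simp) (by simp)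
    exact ⟨c, hc, by grind⟩
  · obtain ⟨c, hc, h₁⟩ := h.glue_ne hm ha.1 hb.1 hA₀ hB₂ (by simp) (by simp)
    exact ⟨c, hc, by grind⟩
  · obtain ⟨c, hc, h₁⟩ := h.glue_ne hm ha.1 hb.1 hA₃ hB₀ (by simp) (by simp)
    exact ⟨c, hc, by grind⟩
  · obtain ⟨c, hc, h₁⟩ := h.glue_ne hm ha.1 hb.1 hA₁ hB₁ (by simp) (by simp)
    exact ⟨c, hc, by grind⟩

theorem exists_single_separator (h : G.TwoSeparation S A B p q) (hm : 4 ≤ m)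
    (hA : G.FlexiblyColourable m A) (hB : G.FlexiblyColourable m B)
    (ha : a ∈ A \ B) (hb : b ∈ B \ A) :
    ∃ c : V → Fin m, G.ProperOn S c ∧ c p ≠ c a ∧ c p ≠ c b := by
  rcases h.patterns hA ha with hA₀ | ⟨hA₁, hA₂, hA₃⟩ <;>
    rcases h.symm.patterns hB hb with hB₀ | ⟨hB₁, hB₂, hB₃⟩
  · obtain ⟨c, hc, h₁⟩ := h.glue_ne hm ha.1 hb.1 hA₀ hB₀ (by simp) (by simp)
    exact ⟨c, hc, by grind⟩
  · obtain ⟨c, hc, h₁⟩ := h.glue_ne hm ha.1 hb.1 hA₀ hB₃ (by simp) (by simp)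
    exact ⟨c, hc, by grind⟩
  · obtain ⟨c, hc, h₁⟩ := h.glue_ne hm ha.1 hb.1 hA₃ hB₀ (by simp) (by simp)
    exact ⟨c, hc, by grind⟩
  · obtain ⟨c, hc, h₁⟩ := h.glue_ne hm ha.1 hb.1 hA₁ hB₁ (by simp) (by simp)
    exact ⟨c, hc, by grind⟩

variable {x y v : V}

theorem exists_single_right (h : G.TwoSeparation S A B p q) (hm : 4 ≤ m)
    (hA : G.FlexiblyColourable m A) (hB : G.FlexiblyColourable m B)
    (ha : a ∈ A \ B) (hx : x ∈ B \ A) (hy : y ∈ B \ A) (hxy : x ≠ y) :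
    ∃ c : V → Fin m, G.ProperOn S c ∧ c x ≠ c y ∧ c x ≠ c a := by
  have hp := h.left_mem
  have hq := h.right_mem
  obtain ⟨c₂, hc₂, h₁, h₂⟩ := hB.single x hx.1 y hy.1 p hp.2 hxy (h.symm.ne_of_left hx).1
  suffices ∃ t, t ≠ c₂ x ∧ ∃ c : V → Fin m, G.ProperOn S c ∧ (∀ v ∈ B, c v = c₂ v) ∧ c a = t by
    obtain ⟨t, ht, c, hc, hB', hca⟩ := this
    exact ⟨c, hc, by rwa [hB' x hx.1, hB' y hy.1], by rw [hB' x hx.1, hca]; exact ht.symm⟩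
  obtain ⟨t, t₁, t₂, t₃⟩ := exists_fin_ne_three hm (c₂ p) (c₂ q) (c₂ x)
  by_cases hpq : c₂ p = c₂ q
  · rcases hA.hasPattern_eq (a := a) hp.1 hq.1 h.ne (fun hadj => hc₂ p hp.2 q hq.2 hadj hpq)
      with hA' | hA'
    · exact ⟨t, t₃, h.extend ha.1 hA' hc₂ t (by grind) (by grind) (by grind)⟩
    · exact ⟨c₂ p, h₂.symm, h.extend ha.1 hA' hc₂ _ (by grind) (by grind) (by grind)⟩
  · rcases h.patterns hA ha with hA' | ⟨-, hA', -⟩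
    · exact ⟨t, t₃, h.extend ha.1 hA' hc₂ t (by grind) (by grind) (by grind)⟩
    · exact ⟨c₂ p, h₂.symm, h.extend ha.1 hA' hc₂ _ (by grind) (by grind) (by grind)⟩

theorem exists_pair_right (h : G.TwoSeparation S A B p q) (hm : 4 ≤ m)
    (hA : G.FlexiblyColourable m A) (hB : G.FlexiblyColourable m B)
    (ha : a ∈ A \ B) (hb : b ∈ B \ A) (hv : v ∈ B \ A) :
    ∃ c : V → Fin m, G.ProperOn S c ∧
      (c a = c b ∧ c a ≠ c v ∨ c a = c v ∧ c a ≠ c b ∨ c b = c v ∧ c a ≠ c b) := by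
  have hp := h.left_mem
  have hq := h.right_mem
  obtain ⟨hap, haq⟩ := h.ne_of_left ha
  obtain ⟨hbp, hbq⟩ := h.symm.ne_of_left hb
  obtain ⟨hvp, hvq⟩ := h.symm.ne_of_left hv
  suffices ∃ c₂ : V → Fin m, ∃ t, (t = c₂ b ∧ t ≠ c₂ v ∨ t = c₂ v ∧ t ≠ c₂ b ∨
      c₂ b = c₂ v ∧ t ≠ c₂ b) ∧
      ∃ c : V → Fin m, G.ProperOn S c ∧ (∀ v ∈ B, c v = c₂ v) ∧ c a = t by
    obtain ⟨c₂, t, ht, c, hc, hB', hca⟩ := this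
    exact ⟨c, hc, by rwa [hB' b hb.1, hB' v hv.1, hca]⟩
  by_cases hA₁ : G.HasPattern m A a p q True False False
  · obtain ⟨c₂, hc₂, hpq⟩ := hB.eq p hp.2 q hq.2 h.ne (hA₁.not_adj hp.1 hq.1)
    obtain ⟨t, t₁, t₂, t₃⟩ := exists_fin_ne_three hm (c₂ p) (c₂ b) (c₂ v)
    by_cases hbv : c₂ b = c₂ v
    · exact ⟨c₂, t, by grind, h.extend ha.1 hA₁ hc₂ _ (by grind) (by grind) (by grind)⟩
    · by_cases hbp : c₂ b = c₂ p
      · exact ⟨c₂, c₂ v, by grind, h.extend ha.1 hA₁ hc₂ _ (by grind) (by grind) (by grind)⟩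
      · exact ⟨c₂, c₂ b, by grind, h.extend ha.1 hA₁ hc₂ _ (by grind) (by grind) (by grind)⟩
  have hA₀ := (hA.hasPattern_single ha.1 hp.1 hq.1 hap haq).resolve_right hA₁
  have key : ∀ c₂ : V → Fin m, G.ProperOn B c₂ → c₂ p ≠ c₂ q →
      (c₂ b = c₂ v ∨ c₂ b ≠ c₂ p ∧ c₂ b ≠ c₂ q ∨ c₂ v ≠ c₂ p ∧ c₂ v ≠ c₂ q) →
      ∃ t, (t = c₂ b ∧ t ≠ c₂ v ∨ t = c₂ v ∧ t ≠ c₂ b ∨ c₂ b = c₂ v ∧ t ≠ c₂ b) ∧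
      ∃ c : V → Fin m, G.ProperOn S c ∧ (∀ v ∈ B, c v = c₂ v) ∧ c a = t := by
    intro c₂ hc₂ hpq hbv
    obtain ⟨t, t₁, t₂, t₃⟩ := exists_fin_ne_three hm (c₂ p) (c₂ q) (c₂ b)
    by_cases hbv' : c₂ b = c₂ v
    · exact ⟨t, by grind, h.extend ha.1 hA₀ hc₂ _ (by grind) (by grind) (by grind)⟩
    · rcases hbv.resolve_left hbv' with hb' | hv'
      · exact ⟨c₂ b, by grind, h.extend ha.1 hA₀ hc₂ _ (by grind) (by grind) (by grind)⟩
      · exact ⟨c₂ v, by grind, h.extend ha.1 hA₀ hc₂ _ (by grind) (by grind) (by grind)⟩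
  by_cases hadj : G.Adj p q
  · obtain ⟨c₂, hc₂, h₁, h₂⟩ := hB.single p hp.2 b hb.1 v hv.1 hbp.symm hvp.symm
    exact ⟨c₂, key c₂ hc₂ (hc₂ p hp.2 q hq.2 hadj) (by grind)⟩
  · obtain ⟨c₂, hc₂, hpq, -⟩ := hB.single p hp.2 q hq.2 q hq.2 h.ne h.ne
    by_cases hbv : c₂ b = c₂ v ∨ c₂ b ≠ c₂ p ∧ c₂ b ≠ c₂ q ∨ c₂ v ≠ c₂ p ∧ c₂ v ≠ c₂ q
    · exact ⟨c₂, key c₂ hc₂ hpq hbv⟩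
    · rcases (hA.hasPattern_pair ha.1 hp.1 hq.1 hap haq h.ne
        (fun h' => hadj h'.2.2)).resolve_left hA₁ with hA' | hA'
      · exact ⟨c₂, c₂ p, by grind, h.extend ha.1 hA' hc₂ _ (by grind) (by grind) (by grind)⟩
      · exact ⟨c₂, c₂ q, by grind, h.extend ha.1 hA' hc₂ _ (by grind) (by grind) (by grind)⟩

theorem exists_single_left (h : G.TwoSeparation S A B p q) (hm : 4 ≤ m)
    (hK : m = 4 → ∀ p q y z, G.Adj p q → G.Adj p y → G.Adj p z → G.Adj q y → G.Adj q z →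
      ¬ G.Adj y z)
    (hA : G.FlexiblyColourable m A) (hB : G.FlexiblyColourable m B)
    (ha : a ∈ A \ B) (hb : b ∈ B \ A) (hv : v ∈ B \ A) :
    ∃ c : V → Fin m, G.ProperOn S c ∧ c a ≠ c b ∧ c a ≠ c v := by
  have hp := h.left_mem
  have hq := h.right_mem
  obtain ⟨hap, haq⟩ := h.ne_of_left ha
  obtain ⟨hbp, hbq⟩ := h.symm.ne_of_left hb
  obtain ⟨hvp, hvq⟩ := h.symm.ne_of_left hv
  suffices ∃ c₂ : V → Fin m, ∃ t, (t ≠ c₂ b ∧ t ≠ c₂ v) ∧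
      ∃ c : V → Fin m, G.ProperOn S c ∧ (∀ v ∈ B, c v = c₂ v) ∧ c a = t by
    obtain ⟨c₂, t, ht, c, hc, hB', hca⟩ := this
    exact ⟨c, hc, by rwa [hB' b hb.1, hB' v hv.1, hca]⟩
  by_cases hA₁ : G.HasPattern m A a p q True False False
  · obtain ⟨c₂, hc₂, hpq⟩ := hB.eq p hp.2 q hq.2 h.ne (hA₁.not_adj hp.1 hq.1)
    obtain ⟨t, t₁, t₂, t₃⟩ := exists_fin_ne_three hm (c₂ p) (c₂ b) (c₂ v)
    exact ⟨c₂, t, by grind, h.extend ha.1 hA₁ hc₂ _ (by grind) (by grind) (by grind)⟩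
  have hA₀ := (hA.hasPattern_single ha.1 hp.1 hq.1 hap haq).resolve_right hA₁
  have key : ∀ c₂ : V → Fin m, G.ProperOn B c₂ → c₂ p ≠ c₂ q →
      (∃ t, t ≠ c₂ p ∧ t ≠ c₂ q ∧ t ≠ c₂ b ∧ t ≠ c₂ v) →
      ∃ t, (t ≠ c₂ b ∧ t ≠ c₂ v) ∧
      ∃ c : V → Fin m, G.ProperOn S c ∧ (∀ v ∈ B, c v = c₂ v) ∧ c a = t := by
    intro c₂ hc₂ hpq ⟨t, t₁, t₂, t₃, t₄⟩
    exact ⟨t, by grind, h.extend ha.1 hA₀ hc₂ _ (by grind) (by grind) (by grind)⟩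
  by_cases hadj : G.Adj p q
  · have key' : ∀ u ∈ B, ∀ w ∈ B, u ≠ w → ¬ G.Adj u w →
        (∀ c₂ : V → Fin m, c₂ u = c₂ w → ∃ x y z, ∀ t, t ≠ x → t ≠ y → t ≠ z →
          t ≠ c₂ p ∧ t ≠ c₂ q ∧ t ≠ c₂ b ∧ t ≠ c₂ v) →
        ∃ c₂ : V → Fin m, ∃ t, (t ≠ c₂ b ∧ t ≠ c₂ v) ∧
          ∃ c : V → Fin m, G.ProperOn S c ∧ (∀ v ∈ B, c v = c₂ v) ∧ c a = t := by
      intro u hu w hw huw hn hx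
      obtain ⟨c₂, hc₂, he⟩ := hB.eq u hu w hw huw hn
      obtain ⟨x, y, z, hxyz⟩ := hx c₂ he
      obtain ⟨t, t₁, t₂, t₃⟩ := exists_fin_ne_three hm x y z
      exact ⟨c₂, key c₂ hc₂ (hc₂ p hp.2 q hq.2 hadj) ⟨t, hxyz t t₁ t₂ t₃⟩⟩
    by_cases hbv : b = v
    · subst hbv
      obtain ⟨c₂, hc₂, h₁, -⟩ := hB.single p hp.2 q hq.2 q hq.2 h.ne h.ne
      obtain ⟨t, t₁, t₂, t₃⟩ := exists_fin_ne_three hm (c₂ p) (c₂ q) (c₂ b)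
      exact ⟨c₂, key c₂ hc₂ h₁ ⟨t, t₁, t₂, t₃, t₃⟩⟩
    by_cases hm' : m = 4
    · by_cases h₁ : G.Adj p b
      · by_cases h₂ : G.Adj p v
        · by_cases h₃ : G.Adj q b
          · by_cases h₄ : G.Adj q v
            · exact key' b hb.1 v hv.1 hbv (hK hm' p q b v hadj h₁ h₂ h₃ h₄)
                fun c₂ _ => ⟨c₂ p, c₂ q, c₂ b, by grind⟩
            · exact key' q hq.2 v hv.1 hvq.symm h₄ fun c₂ _ => ⟨c₂ p, c₂ q, c₂ b, by grind⟩
          · exact key' q hq.2 b hb.1 hbq.symm h₃ fun c₂ _ => ⟨c₂ p, c₂ q, c₂ v, by grind⟩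
        · exact key' p hp.2 v hv.1 hvp.symm h₂ fun c₂ _ => ⟨c₂ p, c₂ q, c₂ b, by grind⟩
      · exact key' p hp.2 b hb.1 hbp.symm h₁ fun c₂ _ => ⟨c₂ p, c₂ q, c₂ v, by grind⟩
    · obtain ⟨c₂, hc₂, h₁, -⟩ := hB.single p hp.2 q hq.2 q hq.2 h.ne h.ne
      exact ⟨c₂, key c₂ hc₂ h₁ (exists_fin_ne_four (by omega) _ _ _ _)⟩
  · obtain ⟨c₂, hc₂, h₁, h₂⟩ := hB.single p hp.2 b hb.1 v hv.1 hbp.symm hvp.symm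
    by_cases hpq : c₂ p = c₂ q
    · have hA' := (hA.hasPattern_eq (a := a) hp.1 hq.1 h.ne hadj).resolve_left hA₁
      exact ⟨c₂, c₂ p, ⟨h₁, h₂⟩, h.extend ha.1 hA' hc₂ _ (by grind) (by grind) (by grind)⟩
    · rcases (hA.hasPattern_pair ha.1 hp.1 hq.1 hap haq h.ne
        (fun h' => hadj h'.2.2)).resolve_left hA₁ with hA' | hA'
      · exact ⟨c₂, c₂ p, ⟨h₁, h₂⟩, h.extend ha.1 hA' hc₂ _ (by grind) (by grind) (by grind)⟩
      · by_cases hqb : c₂ q = c₂ b ∨ c₂ q = c₂ v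
        · obtain ⟨t, t₁, t₂, t₃⟩ := exists_fin_ne_three hm (c₂ p) (c₂ b) (c₂ v)
          exact ⟨c₂, key c₂ hc₂ hpq ⟨t, by grind⟩⟩
        · exact ⟨c₂, c₂ q, by grind, h.extend ha.1 hA' hc₂ _ (by grind) (by grind) (by grind)⟩

theorem exists_pair (h : G.TwoSeparation S A B p q) (hm : 4 ≤ m)
    (hA : G.FlexiblyColourable m A) (hB : G.FlexiblyColourable m B)
    (ha : a ∈ A \ B) (hv : v ∈ B \ A) (hb : b ∈ S) :
    ∃ c : V → Fin m, G.ProperOn S c ∧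
      (c a = c b ∧ c a ≠ c v ∨ c a = c v ∧ c a ≠ c b ∨ c b = c v ∧ c a ≠ c b) := by
  rcases h.cases hb with hb | hb | rfl | rfl
  · exact (h.symm.exists_pair_right hm hB hA hv ha hb).imp fun c hc => ⟨hc.1, by grind⟩
  · exact h.exists_pair_right hm hA hB ha hb hv
  · exact h.exists_pair_separator hm hA hB ha hv
  · exact h.swap.exists_pair_separator hm hA hB ha hv

theorem exists_single (h : G.TwoSeparation S A B p q) (hm : 4 ≤ m)
    (hA : G.FlexiblyColourable m A) (hB : G.FlexiblyColourable m B)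
    (hK : m = 4 → ∀ p q y z, G.Adj p q → G.Adj p y → G.Adj p z → G.Adj q y → G.Adj q z →
      ¬ G.Adj y z)
    (hx : x ∈ A \ B) (hv : v ∈ B \ A) (hy : y ∈ S) (hxy : x ≠ y) :
    ∃ c : V → Fin m, G.ProperOn S c ∧ c x ≠ c y ∧ c x ≠ c v := by
  rcases h.cases hy with hy | hy | rfl | rfl
  · exact h.symm.exists_single_right hm hB hA hv hx hy hxy
  · exact h.exists_single_left hm hK hA hB hx hy hv
  · exact h.exists_single_left_separator hm hA hB hx hv
  · exact h.swap.exists_single_left_separator hm hA hB hx hv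

theorem exists_single_of_mem (h : G.TwoSeparation S A B p q) (hm : 4 ≤ m)
    (hA : G.FlexiblyColourable m A) (hB : G.FlexiblyColourable m B)
    (hK : m = 4 → ∀ p q y z, G.Adj p q → G.Adj p y → G.Adj p z → G.Adj q y → G.Adj q z →
      ¬ G.Adj y z)
    (hv : v ∈ B \ A) (hy : y ∈ A \ B) (hx : x ∈ S) (hxy : x ≠ y) (hxv : x ≠ v) :
    ∃ c : V → Fin m, G.ProperOn S c ∧ c x ≠ c y ∧ c x ≠ c v := by
  rcases h.cases hx with hx' | hx' | rfl | rfl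
  · exact h.exists_single hm hA hB hK hx' hv ((h.mem_iff y).2 (Or.inl hy.1)) hxy
  · exact (h.symm.exists_single hm hB hA hK hx' hy ((h.mem_iff v).2 (Or.inr hv.1)) hxv).imp
      fun c hc => ⟨hc.1, hc.2.2, hc.2.1⟩
  · exact h.exists_single_separator hm hA hB hy hv
  · exact h.swap.exists_single_separator hm hA hB hy hv

theorem exists_crossing (h : G.TwoSeparation S A B p q) (hx : x ∈ S) (hy : y ∈ S) (hv : v ∈ S)
    (hA : ¬ (x ∈ A ∧ y ∈ A ∧ v ∈ A)) (hB : ¬ (x ∈ B ∧ y ∈ B ∧ v ∈ B)) :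
    (x ∈ A \ B ∧ v ∈ B \ A) ∨ (x ∈ A \ B ∧ y ∈ B \ A) ∨ (x ∈ B \ A ∧ v ∈ A \ B) ∨
      (x ∈ B \ A ∧ y ∈ A \ B) ∨ (y ∈ A \ B ∧ v ∈ B \ A) ∨ (y ∈ B \ A ∧ v ∈ A \ B) := by
  rw [h.mem_iff] at hx hy hv
  simp only [Set.mem_sdiff]
  grind

theorem flexiblyColourable (h : G.TwoSeparation S A B p q) (hm : 4 ≤ m)
    (hK : m = 4 → ∀ p q y z, G.Adj p q → G.Adj p y → G.Adj p z → G.Adj q y → G.Adj q z →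
      ¬ G.Adj y z)
    (hA : G.FlexiblyColourable m A) (hB : G.FlexiblyColourable m B) :
    G.FlexiblyColourable m S where
  eq u hu v hv huv hadj := by
    by_cases huvA : u ∈ A ∧ v ∈ A
    · obtain ⟨c₁, hc₁, h₁⟩ := hA.eq u huvA.1 v huvA.2 huv hadj
      obtain ⟨c, hc, hc'⟩ := h.symm.extend_right hB hc₁
      exact ⟨c, hc, by rwa [hc' u huvA.1, hc' v huvA.2]⟩
    by_cases huvB : u ∈ B ∧ v ∈ B
    · obtain ⟨c₁, hc₁, h₁⟩ := hB.eq u huvB.1 v huvB.2 huv hadj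
      obtain ⟨c, hc, hc'⟩ := h.extend_right hA hc₁
      exact ⟨c, hc, by rwa [hc' u huvB.1, hc' v huvB.2]⟩
    have hu' := (h.mem_iff u).1 hu
    have hv' := (h.mem_iff v).1 hv
    by_cases huA : u ∈ A
    · exact h.exists_eq hA hB ⟨huA, by tauto⟩ ⟨by tauto, by tauto⟩
    · exact h.symm.exists_eq hB hA ⟨by tauto, huA⟩ ⟨by tauto, by tauto⟩
  single x hx y hy z hz hxy hxz := by
    by_cases hxyzA : x ∈ A ∧ y ∈ A ∧ z ∈ A
    · obtain ⟨hxA, hyA, hzA⟩ := hxyzA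
      obtain ⟨c₁, hc₁, h₁⟩ := hA.single x hxA y hyA z hzA hxy hxz
      obtain ⟨c, hc, hc'⟩ := h.symm.extend_right hB hc₁
      exact ⟨c, hc, by rwa [hc' x hxA, hc' y hyA, hc' z hzA]⟩
    by_cases hxyzB : x ∈ B ∧ y ∈ B ∧ z ∈ B
    · obtain ⟨hxB, hyB, hzB⟩ := hxyzB
      obtain ⟨c₁, hc₁, h₁⟩ := hB.single x hxB y hyB z hzB hxy hxz
      obtain ⟨c, hc, hc'⟩ := h.extend_right hA hc₁
      exact ⟨c, hc, by rwa [hc' x hxB, hc' y hyB, hc' z hzB]⟩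
    rcases h.exists_crossing hx hy hz hxyzA hxyzB with hc | hc | hc | hc | hc | hc
    · exact h.exists_single hm hA hB hK hc.1 hc.2 hy hxy
    · exact (h.exists_single hm hA hB hK hc.1 hc.2 hz hxz).imp fun c hc => ⟨hc.1, hc.2.2, hc.2.1⟩
    · exact h.symm.exists_single hm hB hA hK hc.1 hc.2 hy hxy
    · exact (h.symm.exists_single hm hB hA hK hc.1 hc.2 hz hxz).imp fun c hc => ⟨hc.1, hc.2.2, hc.2.1⟩
    · exact h.exists_single_of_mem hm hA hB hK hc.2 hc.1 hx hxy hxz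
    · exact h.symm.exists_single_of_mem hm hB hA hK hc.2 hc.1 hx hxy hxz
  pair a ha b hb v hv hab hav hbv hadj := by
    by_cases habvA : a ∈ A ∧ b ∈ A ∧ v ∈ A
    · obtain ⟨haA, hbA, hvA⟩ := habvA
      obtain ⟨c₁, hc₁, h₁⟩ := hA.pair a haA b hbA v hvA hab hav hbv hadj
      obtain ⟨c, hc, hc'⟩ := h.symm.extend_right hB hc₁
      exact ⟨c, hc, by rwa [hc' a haA, hc' b hbA, hc' v hvA]⟩
    by_cases habvB : a ∈ B ∧ b ∈ B ∧ v ∈ B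
    · obtain ⟨haB, hbB, hvB⟩ := habvB
      obtain ⟨c₁, hc₁, h₁⟩ := hB.pair a haB b hbB v hvB hab hav hbv hadj
      obtain ⟨c, hc, hc'⟩ := h.extend_right hA hc₁
      exact ⟨c, hc, by rwa [hc' a haB, hc' b hbB, hc' v hvB]⟩
    rcases h.exists_crossing ha hb hv habvA habvB with hc | hc | hc | hc | hc | hc
    · exact (h.exists_pair hm hA hB hc.1 hc.2 hb).imp fun c hc => ⟨hc.1, by grind⟩
    · exact (h.exists_pair hm hA hB hc.1 hc.2 hv).imp fun c hc => ⟨hc.1, by grind⟩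
    · exact (h.symm.exists_pair hm hB hA hc.1 hc.2 hb).imp fun c hc => ⟨hc.1, by grind⟩
    · exact (h.symm.exists_pair hm hB hA hc.1 hc.2 hv).imp fun c hc => ⟨hc.1, by grind⟩
    · exact (h.exists_pair hm hA hB hc.1 hc.2 ha).imp fun c hc => ⟨hc.1, by grind⟩
    · exact (h.symm.exists_pair hm hB hA hc.1 hc.2 ha).imp fun c hc => ⟨hc.1, by grind⟩

end TwoSeparation

theorem ProperOn.update {m : ℕ} {G : SimpleGraph V} [DecidableEq V] {S : Set V} {c : V → Fin m}
    {k : Fin m} (hc : G.ProperOn S c) (hk : ∀ v ∈ S, c v ≠ k) (u v : V) (hadj : ¬ G.Adj u v) :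
    G.ProperOn S fun w => if w = u ∨ w = v then k else c w := by
  intro x hx y hy hxy
  have := hc x hx y hy hxy
  have := hk x hx
  have := hk y hy
  have := hxy.ne
  have := hxy.symm
  grind

/-- A proper colouring leaving one colour unused can be recoloured freely with that colour on
one vertex or on two nonadjacent vertices. -/
theorem ProperOn.flexiblyColourable {m : ℕ} {G : SimpleGraph V} {S : Set V} {c : V → Fin m}
    {k : Fin m} (hc : G.ProperOn S c) (hk : ∀ v ∈ S, c v ≠ k) : G.FlexiblyColourable m S := by
  classical
  have key := hc.update hk
  refine ⟨fun u hu v hv huv hadj => ⟨_, key u v hadj, by simp⟩,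
    fun x hx y hy z hz hxy hxz => ⟨_, key x x (G.irrefl), ?_⟩,
    fun a ha b hb v hv hab hav hbv hadj => ?_⟩
  · have := hk y hy
    have := hk z hz
    grind
  · have := hk a ha
    have := hk b hb
    have := hk v hv
    by_cases h₁ : G.Adj a b
    · by_cases h₂ : G.Adj a v
      · exact ⟨_, key b v (by tauto), by grind⟩
      · exact ⟨_, key a v h₂, by grind⟩
    · exact ⟨_, key a b h₁, by grind⟩

theorem exists_properOn_of_colorable {m : ℕ} {G : SimpleGraph V} {S : Set V} (hm : 0 < m)
    (h : (G.induce S).Colorable (m - 1)) :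
    ∃ (c : V → Fin m) (k : Fin m), G.ProperOn S c ∧ ∀ v ∈ S, c v ≠ k := by
  classical
  obtain ⟨C⟩ := h
  refine ⟨fun v => if hv : v ∈ S then (C ⟨v, hv⟩).castLE (Nat.sub_le m 1) else ⟨0, hm⟩,
    ⟨m - 1, by omega⟩, fun u hu v hv huv => ?_, fun v hv => ?_⟩
  · have : C ⟨u, hu⟩ ≠ C ⟨v, hv⟩ := C.valid (by simpa using huv)
    simpa [hu, hv] using this
  · have := (C ⟨v, hv⟩).isLt
    simp only [hv, dite_true, ne_eq, Fin.ext_iff, Fin.val_castLE]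
    omega

/-- A separator with at most two vertices can be enlarged to one with exactly two. -/
theorem exists_twoSeparation [Finite V] {G : SimpleGraph V} {P Q X : Set V}
    (hPX : Disjoint P X) (hQX : Disjoint Q X) (hPQ : Disjoint P Q)
    (hP : P.Nonempty) (hQ : Q.Nonempty)
    (hadj : ∀ u ∈ P, ∀ v ∈ Q, ¬ G.Adj u v) (hX : X.ncard ≤ 2)
    (hcard : 4 ≤ P.ncard + Q.ncard + X.ncard) :
    ∃ A B p q, G.TwoSeparation (P ∪ Q ∪ X) A B p q := by
  induction hn : 2 - X.ncard generalizing P Q X with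
  | zero =>
    obtain ⟨p, q, hpq, rfl⟩ := Set.ncard_eq_two.1 (show X.ncard = 2 by omega)
    rw [Set.disjoint_left] at hPX hQX hPQ
    have hA : (P ∪ {p, q}) \ (Q ∪ {p, q}) = P := by
      ext v; have := @hPX v; have := @hPQ v; simp only [Set.mem_sdiff, Set.mem_union]; tauto
    have hB : (Q ∪ {p, q}) \ (P ∪ {p, q}) = Q := by
      ext v; have := @hQX v; have := @hPQ v; simp only [Set.mem_sdiff, Set.mem_union]; tauto
    refine ⟨P ∪ {p, q}, Q ∪ {p, q}, p, q, hpq, ?_, ?_, ?_, ?_, ?_⟩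
    · ext v; simp only [Set.mem_union]; tauto
    · ext v; have := @hPQ v; grind
    · rwa [hA, hB]
    · rwa [hA]
    · rwa [hB]
  | succ n ih =>
    wlog h : 2 ≤ P.ncard generalizing P Q
    · rw [Set.union_comm P Q]
      exact this hQX hPX hPQ.symm hQ hP (fun u hu v hv huv => hadj v hv u hu huv.symm)
        (by omega) (by omega)
    obtain ⟨w, hw⟩ := hP
    have hwX : w ∉ X := Set.disjoint_left.1 hPX hw
    have h₁ : (P \ {w}).ncard = P.ncard - 1 := Set.ncard_sdiff_singleton_of_mem hw
    have h₂ : (insert w X).ncard = X.ncard + 1 := Set.ncard_insert_of_notMem hwX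
    have hS : P ∪ Q ∪ X = P \ {w} ∪ Q ∪ insert w X := by
      ext v
      simp only [Set.mem_union, Set.mem_sdiff, Set.mem_insert_iff, Set.mem_singleton_iff]
      by_cases hv : v = w
      · subst hv; tauto
      · tauto
    rw [hS]
    refine ih ?_ ?_ (hPQ.mono_left Set.sdiff_subset) ?_ hQ
      (fun u hu => hadj u hu.1) (by omega) (by omega) (by omega)
    · rw [Set.disjoint_insert_right]
      exact ⟨by simp, hPX.mono_left Set.sdiff_subset⟩
    · rw [Set.disjoint_insert_right]
      exact ⟨Set.disjoint_left.1 hPQ hw, hQX⟩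
    · exact (Set.ncard_pos).1 (by omega)

theorem exists_twoSeparation_of_not_connected [Finite V] {G : SimpleGraph V} {S : Set V}
    (hcard : 4 ≤ S.ncard) {X : Set S} (hX : X.ncard ≤ 2)
    (h : ¬ ((G.induce S).induce Xᶜ).Connected) :
    ∃ A B p q, G.TwoSeparation S A B p q := by
  classical
  set H := (G.induce S).induce Xᶜ with hH
  have hcompl : X.ncard + (Xᶜ).ncard = S.ncard := by
    rw [Set.ncard_add_ncard_compl, Nat.card_coe_set_eq]
  obtain ⟨w, hw⟩ : (Xᶜ).Nonempty := (Set.ncard_pos).1 (by omega)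
  have : Nonempty (Xᶜ : Set S) := ⟨⟨w, hw⟩⟩
  have hpre : ¬ H.Preconnected := fun hp => h ⟨hp⟩
  simp only [Preconnected, not_forall] at hpre
  obtain ⟨u, v, huv⟩ := hpre
  set P : Set S := {w | ∃ hw : w ∈ Xᶜ, H.Reachable u ⟨w, hw⟩} with hPdef
  set Q : Set S := Xᶜ \ P with hQdef
  have hinj : Function.Injective ((↑) : S → V) := Subtype.val_injective
  have hPX : Disjoint P X := Set.disjoint_left.2 fun w hw => hw.1
  have hQX : Disjoint Q X := Set.disjoint_left.2 fun w hw => hw.1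
  have hPQ : Disjoint P Q := Set.disjoint_left.2 fun w hw hw' => hw'.2 hw
  have hunion : P ∪ Q ∪ X = Set.univ := by
    ext w
    simp only [hQdef, Set.mem_union, Set.mem_sdiff, Set.mem_compl_iff, Set.mem_univ]
    tauto
  have hsum : P.ncard + Q.ncard + X.ncard = S.ncard := by
    rw [← Set.ncard_union_eq hPQ, ← Set.ncard_union_eq (Set.disjoint_union_left.2 ⟨hPX, hQX⟩),
      hunion, Set.ncard_univ, Nat.card_coe_set_eq]
  have key := exists_twoSeparation (G := G) (P := (↑) '' P) (Q := (↑) '' Q) (X := (↑) '' X)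
    (Set.disjoint_image_of_injective hinj hPX) (Set.disjoint_image_of_injective hinj hQX)
    (Set.disjoint_image_of_injective hinj hPQ)
    (Set.Nonempty.image _ ⟨u, u.2, Reachable.refl _⟩)
    (Set.Nonempty.image _ ⟨v, v.2, fun hv => huv hv.2⟩) ?_
    (by rwa [Set.ncard_image_of_injective _ hinj])
    (by simp only [Set.ncard_image_of_injective _ hinj]; omega)
  · rwa [← Set.image_union, ← Set.image_union, hunion, Set.image_univ, Subtype.range_coe] at key
  · rintro _ ⟨x, ⟨hx, hux⟩, rfl⟩ _ ⟨y, ⟨hy, hy'⟩, rfl⟩ hxy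
    refine hy' ⟨hy, hux.trans (Adj.reachable ?_)⟩
    simpa [hH] using hxy

variable [Finite V] {G : SimpleGraph V} {m : ℕ}

theorem MFragile.colouring_or_twoSeparation (hm : 4 ≤ m) (hG : G.MFragile m) (S : Set V) :
    (∃ (c : V → Fin m) (k : Fin m), G.ProperOn S c ∧ ∀ v ∈ S, c v ≠ k) ∨
      ∃ A B p q, G.TwoSeparation S A B p q := by
  by_cases hcard : S.ncard ≤ 3
  · left
    apply exists_properOn_of_colorable (by omega)
    have := Fintype.ofFinite S
    refine (G.induce S).colorable_of_fintype.mono ?_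
    rw [← Nat.card_eq_fintype_card, Nat.card_coe_set_eq]
    omega
  by_cases hconn : (G.induce S).IsKConnected 3
  · left
    apply exists_properOn_of_colorable (by omega)
    have := hG ((⊤ : G.Subgraph).induce S)
    rw [← induce_eq_coe_induce_top] at this
    exact this hconn
  · right
    simp only [IsKConnected, Nat.card_coe_set_eq, not_and, not_forall] at hconn
    obtain ⟨X, hX, h⟩ := hconn (by omega)
    exact exists_twoSeparation_of_not_connected (by omega) hX h

theorem MFragile.no_four_clique (hm : 4 ≤ m) (hG : G.MFragile m) (hm' : m = 4) (p q y z : V)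
    (hpq : G.Adj p q) (hpy : G.Adj p y) (hpz : G.Adj p z) (hqy : G.Adj q y) (hqz : G.Adj q z) :
    ¬ G.Adj y z := by
  intro hyz
  subst hm'
  rcases hG.colouring_or_twoSeparation hm {p, q, y, z} with ⟨c, k, hc, hk⟩ | ⟨A, B, a, b, h⟩
  · have := hc p (by simp) q (by simp) hpq
    have := hc p (by simp) y (by simp) hpy
    have := hc p (by simp) z (by simp) hpz
    have := hc q (by simp) y (by simp) hqy
    have := hc q (by simp) z (by simp) hqz
    have := hc y (by simp) z (by simp) hyz
    have := hk p (by simp)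
    have := hk q (by simp)
    have := hk y (by simp)
    have := hk z (by simp)
    omega
  · obtain ⟨u, hu⟩ := h.left_nonempty
    obtain ⟨v, hv⟩ := h.right_nonempty
    have huS := (h.mem_iff u).2 (Or.inl hu.1)
    have hvS := (h.mem_iff v).2 (Or.inr hv.1)
    have huv : u ≠ v := fun e => hu.2 (e ▸ hv.1)
    have hadj := h.not_adj u hu v hv
    simp only [Set.mem_insert_iff, Set.mem_singleton_iff] at huS hvS
    rcases huS with rfl | rfl | rfl | rfl <;> rcases hvS with rfl | rfl | rfl | rfl <;>
      simp_all [adj_comm]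

theorem MFragile.flexiblyColourable (hm : 4 ≤ m) (hG : G.MFragile m) (S : Set V) :
    G.FlexiblyColourable m S := by
  induction hn : S.ncard using Nat.strong_induction_on generalizing S with
  | _ n ih =>
    subst hn
    rcases hG.colouring_or_twoSeparation hm S with ⟨c, k, hc, hk⟩ | ⟨A, B, p, q, h⟩
    · exact hc.flexiblyColourable hk
    · exact h.flexiblyColourable hm (hG.no_four_clique hm)
        (ih _ (Set.ncard_lt_ncard h.ssubset) A rfl) (ih _ (Set.ncard_lt_ncard h.symm.ssubset) B rfl)

end SimpleGraph

/-- Every `m`-fragile graph admits an `m`-colouring in which a given vertex `x` gets a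
colour different from those of two other given vertices `y` and `z`. -/
theorem statement5 {V : Type*} [Fintype V] (G : SimpleGraph V) (m : ℕ) (hm : 4 ≤ m)
    (hG : G.MFragile m) (x y z : V) (hxy : x ≠ y) (hxz : x ≠ z) (hyz : y ≠ z) :
    ∃ c : V → ℕ, (∀ v, c v ∈ Finset.Icc 1 m) ∧ (∀ u v, G.Adj u v → c u ≠ c v) ∧
      c x ∉ ({c y, c z} : Set ℕ) := by
  obtain ⟨c, hc, h₁, h₂⟩ := (hG.flexiblyColourable hm Set.univ).single x (Set.mem_univ x)
    y (Set.mem_univ y) z (Set.mem_univ z) hxy hxz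
  refine ⟨fun v => (c v : ℕ) + 1, fun v => ?_, fun u v huv => ?_, ?_⟩
  · have := (c v).isLt
    simp only [Finset.mem_Icc]
    omega
  · have := hc u (Set.mem_univ u) v (Set.mem_univ v) huv
    simpa [Fin.ext_iff] using this
  · simpa [Fin.ext_iff] using And.intro h₁ h₂
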